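/- (Uniform fast-rate square-loss concentration over function and policy classes on adaptively collected episodes.) Let MG be an m-player finite Markov game, fix player i and a Markov joint policy π_{-i} of the other players. Let Π_i be a finite class of deterministic Markov policies π_i = (π_{i,h}: S → A_i)_{h∈[H]} of player i, and let F_i = F_{i,1} × … × F_{i,H} be a finite class with each f_h ∈ F_{i,h} a function S × A_i → [0, H] (convention f_{H+1} ≡ 0). Suppose K episodes of data are collected: in episode t ∈ [K], a policy π_i^t ∈ Π_i is selected measurably from the first t−1 episodes, and a trajectory (s_1^t, a_{i,1}^t, r_{i,1}^t, …, s_H^t, a_{i,H}^t, r_{i,H}^t, s_{H+1}^t) is generated by playing π_i^t × π_{-i}. For (f, π_i) ∈ F_i × Π_i define X_h^t(f, π_i) := 2 ( f_h − T^{π_i×π_{-i}}_{i,h} f_{h+1} )(s_h^t, a_{i,h}^t) · [ r_{i,h}^t + f_{h+1}( s_{h+1}^t, π_{i,h+1}(s_{h+1}^t) ) − ( T^{π_i×π_{-i}}_{i,h} f_{h+1} )(s_h^t, a_{i,h}^t) ]. Then with probability at least 1−δ, simultaneously for all f ∈ F_i, π_i ∈ Π_i, k ∈ [K], h ∈ [H]: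 Σ_{t=1}^{k} X_h^t(f, π_i) ≤ (1/2) Σ_{t=1}^{k} [ ( f_h − T^{π_i×π_{-i}}_{i,h} f_{h+1} )(s_h^t, a_{i,h}^t) ]² + 8 H² log( |F_i| |Π_i| K H / δ ). -/

import Mathlib

open MeasureTheory Finset

/-- A probability vector on a finite type. -/
def IsDist {α : Type*} [Fintype α] (p : α → ℝ) : Prop :=
  (∀ a, 0 ≤ p a) ∧ ∑ a, p a = 1

/-- Combine player `i`'s action with a profile of actions of the other players into a
joint action. -/
def combine {m : ℕ} {A : Fin m → Type*} (i : Fin m) (ai : A i)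
    (an : ∀ j : {j : Fin m // j ≠ i}, A j.1) (j : Fin m) : A j :=
  if h : j = i then cast (congrArg A h).symm ai else an ⟨j, h⟩

/-- Restrict a joint action to the players other than `i`. -/
def restrict {m : ℕ} {A : Fin m → Type*} (i : Fin m) (a : ∀ j, A j)
    (j : {j : Fin m // j ≠ i}) : A j.1 :=
  a j.1

/-- Player `i`'s marginal Bellman operator at step `h`, with the other players playing
`πneg` and player `i` playing `polNext` at step `h + 1`:
`(T f)(s, aᵢ) = E_{a₋ᵢ ∼ πneg h s, s' ∼ P_h(·|s,(aᵢ,a₋ᵢ))}[r + f(s', polNext s')]`. -/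
noncomputable def bell {S : Type*} [Fintype S] {m : ℕ} {A : Fin m → Type*}
    [∀ j, Fintype (A j)] [∀ j, DecidableEq (A j)] (i : Fin m) (P : ℕ → S → (∀ j, A j) → S → ℝ)
    (rew : ℕ → S → (∀ j, A j) → ℝ)
    (πneg : ℕ → S → (∀ j : {j : Fin m // j ≠ i}, A j.1) → ℝ)
    (polNext : S → A i) (h : ℕ) (f : S → A i → ℝ) (s : S) (b : A i) : ℝ :=
  ∑ an, πneg h s an *
    (rew h s (combine i b an) + ∑ s', P h s (combine i b an) s' * f s' (polNext s'))

/-- Hoeffding's lemma for a finitely supported distribution. -/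
lemma IsDist.sum_mul_exp_le {α : Type*} [Fintype α] {p : α → ℝ} (hp : IsDist p)
    {Y : α → ℝ} {c : ℝ} (hY : ∀ a, Y a ∈ Set.Icc 0 c) (u : ℝ) :
    ∑ a, p a * Real.exp (u * (Y a - ∑ b, p b * Y b)) ≤ Real.exp (u ^ 2 * c ^ 2 / 8) := by
  classical
  let _ : MeasurableSpace α := ⊤
  have hsum : ∑ a, ENNReal.ofReal (p a) = 1 := by
    rw [← ENNReal.ofReal_sum_of_nonneg fun a _ => hp.1 a, hp.2, ENNReal.ofReal_one]
  let ν : PMF α := PMF.ofFintype (fun a => ENNReal.ofReal (p a)) hsum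
  have hint (f : α → ℝ) : ∫ a, f a ∂ν.toMeasure = ∑ a, p a * f a := by
    rw [PMF.integral_eq_sum]
    simp [ν, ENNReal.toReal_ofReal (hp.1 _)]
  have hsub := ProbabilityTheory.hasSubgaussianMGF_of_mem_Icc (μ := ν.toMeasure) (X := Y)
    (a := 0) (b := c) (measurable_from_top.aemeasurable) (Filter.Eventually.of_forall hY)
  have hle := hsub.mgf_le u
  rw [ProbabilityTheory.mgf, hint, hint] at hle
  refine hle.trans (Real.exp_le_exp.mpr (le_of_eq ?_))
  simp only [sub_zero, NNReal.coe_pow, NNReal.coe_div, coe_nnnorm, Real.norm_eq_abs,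
    NNReal.coe_ofNat, div_pow, sq_abs]
  ring

/-- A function of a finite-valued random variable is strongly measurable. -/
lemma stronglyMeasurable_comp_of_finite {Ω α : Type*} [Finite α] {m : MeasurableSpace Ω}
    {X : Ω → α} (hX : ∀ x, MeasurableSet[m] {ω | X ω = x}) (F : α → ℝ) :
    StronglyMeasurable[m] fun ω => F (X ω) := by
  let _ : MeasurableSpace α := ⊤
  have hXm : Measurable[m] X := measurable_to_countable' hX
  exact (measurable_from_top.comp hXm).stronglyMeasurable

lemma exists_forall_abs_le_of_finite {α : Type*} [Finite α] (F : α → ℝ) :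
    ∃ C, ∀ x, |F x| ≤ C := by
  obtain ⟨C, hC⟩ := Set.Finite.bddAbove (Set.finite_range fun x => |F x|)
  exact ⟨C, fun x => hC ⟨x, rfl⟩⟩

/-- Disintegration along a finite-valued random variable with a given conditional law. -/
lemma integral_apply_eq_of_condExp {Ω α : Type*} [Fintype α] {m m0 : MeasurableSpace Ω}
    {μ : Measure Ω} [IsProbabilityMeasure μ] (hm : m ≤ m0) {X : Ω → α}
    (hX : ∀ x, MeasurableSet[m0] {ω | X ω = x}) {c : Ω → α → ℝ}
    (hc : ∀ x, μ[Set.indicator {ω | X ω = x} (fun _ => (1 : ℝ)) | m] =ᵐ[μ] fun ω => c ω x)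
    {Φ : Ω → α → ℝ} (hΦ : ∀ x, StronglyMeasurable[m] fun ω => Φ ω x)
    (hΦb : ∀ x, ∃ C, ∀ ω, |Φ ω x| ≤ C) :
    ∫ ω, Φ ω (X ω) ∂μ = ∫ ω, ∑ x, Φ ω x * c ω x ∂μ := by
  classical
  have hI (x : α) : Integrable (Set.indicator {ω | X ω = x} fun _ => (1 : ℝ)) μ :=
    (integrable_const 1).indicator (hX x)
  have hmul (x : α) {g : Ω → ℝ} (hg : Integrable g μ) :
      Integrable (fun ω => Φ ω x * g ω) μ := by
    obtain ⟨C, hC⟩ := hΦb x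
    exact hg.bdd_mul ((hΦ x).mono hm).aestronglyMeasurable
      (Filter.Eventually.of_forall (by simpa using hC))
  have hci (x : α) : Integrable (fun ω => c ω x) μ := integrable_condExp.congr (hc x)
  have hdec : (fun ω => Φ ω (X ω)) =
      fun ω => ∑ x, Φ ω x * Set.indicator {ω | X ω = x} (fun _ => (1 : ℝ)) ω := by
    funext ω
    simp [Set.indicator_apply]
  rw [hdec, integral_finsetSum _ fun x _ => hmul x (hI x),
    integral_finsetSum _ fun x _ => hmul x (hci x)]
  refine Finset.sum_congr rfl fun x _ => ?_
  rw [← integral_condExp hm]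
  refine integral_congr_ae ?_
  filter_upwards [condExp_mul_of_stronglyMeasurable_left (hΦ x) (hmul x (hI x)) (hI x), hc x]
    with ω h1 h2
  have h3 := h1
  simp only [Pi.mul_apply, h2] at h3
  exact h3

/-- One-step supermartingale bound: if the multiplicative increment `φ` has conditional mean at
most one, multiplying a past-measurable weight by it does not increase the expectation. -/
lemma integral_mul_increment_le {Ω S J : Type*} [Fintype S] [Fintype J]
    {m m0 : MeasurableSpace Ω} {μ : Measure Ω} [IsProbabilityMeasure μ] (hm : m ≤ m0)
    {X X' : Ω → S} {a : Ω → J}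
    (hX : ∀ s, MeasurableSet[m] {ω | X ω = s})
    (hX' : ∀ s, MeasurableSet[m0] {ω | X' ω = s})
    (ha : ∀ q, MeasurableSet[m0] {ω | a ω = q})
    {c : Ω → J → ℝ} (hc0 : ∀ ω q, 0 ≤ c ω q)
    (hc : ∀ q, μ[Set.indicator {ω | a ω = q} (fun _ => (1 : ℝ)) | m] =ᵐ[μ] fun ω => c ω q)
    {P : S → J → S → ℝ} (hP0 : ∀ s q s', 0 ≤ P s q s')
    (hP : ∀ s', μ[Set.indicator {ω | X' ω = s'} (fun _ => (1 : ℝ)) |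
      m ⊔ MeasurableSpace.comap a ⊤] =ᵐ[μ] fun ω => P (X ω) (a ω) s')
    {φ : S → J → S → ℝ} (hφ0 : ∀ s q s', 0 ≤ φ s q s')
    (hφ : ∀ ω, ∑ q, c ω q * ∑ s', P (X ω) q s' * φ (X ω) q s' ≤ 1)
    {W : Ω → ℝ} (hW : StronglyMeasurable[m] W) (hW0 : ∀ ω, 0 ≤ W ω)
    (hWb : ∃ C, ∀ ω, |W ω| ≤ C) :
    ∫ ω, W ω * φ (X ω) (a ω) (X' ω) ∂μ ≤ ∫ ω, W ω ∂μ := by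
  obtain ⟨C, hC⟩ := hWb
  have hmulb (F : S × J → ℝ) (Z : Ω → S × J) :
      ∃ C', ∀ ω, |W ω * F (Z ω)| ≤ C' := by
    obtain ⟨B, hB⟩ := exists_forall_abs_le_of_finite F
    refine ⟨C * B, fun ω => ?_⟩
    rw [abs_mul]
    exact mul_le_mul (hC ω) (hB _) (abs_nonneg _) ((abs_nonneg _).trans (hC ω))
  have hcomap : MeasurableSpace.comap a ⊤ ≤ m0 := by
    let _ : MeasurableSpace J := ⊤
    exact (measurable_to_countable' ha : Measurable[m0] a).comap_le
  have hpair (p : S × J) :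
      MeasurableSet[m ⊔ MeasurableSpace.comap a ⊤] {ω | (X ω, a ω) = p} := by
    have h1 : MeasurableSet[m ⊔ MeasurableSpace.comap a ⊤] {ω | X ω = p.1} :=
      (le_sup_left : m ≤ _) _ (hX p.1)
    have h2 : MeasurableSet[m ⊔ MeasurableSpace.comap a ⊤] {ω | a ω = p.2} :=
      (le_sup_right : MeasurableSpace.comap a ⊤ ≤ _) _ ⟨{p.2}, trivial, rfl⟩
    convert MeasurableSet.inter h1 h2 using 1
    ext ω
    simp [Prod.ext_iff]
  rw [integral_apply_eq_of_condExp (Φ := fun ω s' => W ω * φ (X ω) (a ω) s')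
      (sup_le hm hcomap) hX' hP
      (fun s' => (hW.mono (le_sup_left : m ≤ m ⊔ MeasurableSpace.comap a ⊤)).mul
        (stronglyMeasurable_comp_of_finite hpair fun p : S × J => φ p.1 p.2 s'))
      (fun s' => hmulb (fun p => φ p.1 p.2 s') fun ω => (X ω, a ω))]
  have hrew : (fun ω => ∑ s', W ω * φ (X ω) (a ω) s' * P (X ω) (a ω) s') =
      fun ω => W ω * ∑ s', P (X ω) (a ω) s' * φ (X ω) (a ω) s' := by
    funext ω
    rw [Finset.mul_sum]
    exact Finset.sum_congr rfl fun s' _ => by ring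
  rw [hrew, integral_apply_eq_of_condExp
      (Φ := fun ω q => W ω * ∑ s', P (X ω) q s' * φ (X ω) q s') hm ha hc
      (fun q => hW.mul (stronglyMeasurable_comp_of_finite hX
        fun s => ∑ s', P s q s' * φ s q s'))
      (fun q => hmulb (fun p => ∑ s', P p.1 p.2 s' * φ p.1 p.2 s') fun ω => (X ω, q))]
  refine integral_mono_of_nonneg (Filter.Eventually.of_forall fun ω => ?_)
    (Integrable.of_bound (hW.mono hm).aestronglyMeasurable C
      (Filter.Eventually.of_forall hC))
    (Filter.Eventually.of_forall fun ω => ?_)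
  · exact Finset.sum_nonneg fun q _ => mul_nonneg (mul_nonneg (hW0 ω)
      (Finset.sum_nonneg fun s' _ => mul_nonneg (hP0 _ _ _) (hφ0 _ _ _))) (hc0 _ _)
  · calc ∑ q, W ω * (∑ s', P (X ω) q s' * φ (X ω) q s') * c ω q
        = W ω * ∑ q, c ω q * ∑ s', P (X ω) q s' * φ (X ω) q s' := by
          rw [Finset.mul_sum]
          exact Finset.sum_congr rfl fun q _ => by ring
      _ ≤ W ω * 1 := mul_le_mul_of_nonneg_left (hφ ω) (hW0 ω)
      _ = W ω := mul_one _

/-- The product of multiplicative increments with conditional mean at most one has expectation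
at most one. -/
lemma integral_prod_increments_le_one {Ω S J : Type*} [Fintype S] [Fintype J] {K : ℕ}
    {m0 : MeasurableSpace Ω} {μ : Measure Ω} [IsProbabilityMeasure μ]
    {ℱ : ℕ → MeasurableSpace Ω} (hℱ : ∀ t, ℱ t ≤ m0) (hℱmono : ∀ t, ℱ t ≤ ℱ (t + 1))
    {X X' : ℕ → Ω → S} {a : ℕ → Ω → J}
    (hX : ∀ t s, MeasurableSet[ℱ t] {ω | X t ω = s})
    (hX' : ∀ t s, MeasurableSet[ℱ (t + 1)] {ω | X' t ω = s})
    (ha : ∀ t q, MeasurableSet[ℱ (t + 1)] {ω | a t ω = q})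
    {c : ℕ → Ω → J → ℝ} (hc0 : ∀ t ω q, 0 ≤ c t ω q)
    (hc : ∀ t < K, ∀ q,
      μ[Set.indicator {ω | a t ω = q} (fun _ => (1 : ℝ)) | ℱ t] =ᵐ[μ] fun ω => c t ω q)
    {P : S → J → S → ℝ} (hP0 : ∀ s q s', 0 ≤ P s q s')
    (hP : ∀ t < K, ∀ s', μ[Set.indicator {ω | X' t ω = s'} (fun _ => (1 : ℝ)) |
      ℱ t ⊔ MeasurableSpace.comap (a t) ⊤] =ᵐ[μ] fun ω => P (X t ω) (a t ω) s')
    {φ : S → J → S → ℝ} (hφ0 : ∀ s q s', 0 ≤ φ s q s')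
    (hφ : ∀ t ω, ∑ q, c t ω q * ∑ s', P (X t ω) q s' * φ (X t ω) q s' ≤ 1)
    {k : ℕ} (hk : k ≤ K) :
    Integrable (fun ω => ∏ t ∈ Finset.range k, φ (X t ω) (a t ω) (X' t ω)) μ ∧
      ∫ ω, ∏ t ∈ Finset.range k, φ (X t ω) (a t ω) (X' t ω) ∂μ ≤ 1 := by
  have htriple (t : ℕ) (p : S × J × S) :
      MeasurableSet[ℱ (t + 1)] {ω | (X t ω, a t ω, X' t ω) = p} := by
    have h1 : MeasurableSet[ℱ (t + 1)] {ω | X t ω = p.1} := hℱmono t _ (hX t p.1)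
    convert h1.inter ((ha t p.2.1).inter (hX' t p.2.2)) using 1
    ext ω
    simp [Prod.ext_iff]
  have hmeas (n : ℕ) : StronglyMeasurable[ℱ n]
      fun ω => ∏ t ∈ Finset.range n, φ (X t ω) (a t ω) (X' t ω) := by
    induction n with
    | zero => simpa using stronglyMeasurable_const
    | succ n ih =>
      simp only [Finset.prod_range_succ]
      exact (ih.mono (hℱmono n)).mul (stronglyMeasurable_comp_of_finite (htriple n)
        fun p => φ p.1 p.2.1 p.2.2)
  obtain ⟨B, hB⟩ := exists_forall_abs_le_of_finite fun p : S × J × S => φ p.1 p.2.1 p.2.2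
  have hbdd (n : ℕ) (ω : Ω) :
      |∏ t ∈ Finset.range n, φ (X t ω) (a t ω) (X' t ω)| ≤ B ^ n := by
    rw [Finset.abs_prod]
    calc ∏ t ∈ Finset.range n, |φ (X t ω) (a t ω) (X' t ω)|
        ≤ ∏ _t ∈ Finset.range n, B := Finset.prod_le_prod (fun _ _ => abs_nonneg _)
          fun t _ => hB (X t ω, a t ω, X' t ω)
      _ = B ^ n := by simp
  refine ⟨Integrable.of_bound ((hmeas k).mono (hℱ k)).aestronglyMeasurable (B ^ k)
    (Filter.Eventually.of_forall (hbdd k)), ?_⟩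
  induction k with
  | zero => simp
  | succ n ih =>
    simp only [Finset.prod_range_succ]
    exact (integral_mul_increment_le (hℱ n) (hX n) (fun s => hℱ _ _ (hX' n s))
      (fun q => hℱ _ _ (ha n q)) (hc0 n) (hc n hk) hP0 (hP n hk) hφ0 (hφ n) (hmeas n)
      (fun ω => Finset.prod_nonneg fun t _ => hφ0 _ _ _) ⟨_, hbdd n⟩).trans
      (ih (Nat.le_of_succ_le hk))

lemma combine_self {m : ℕ} {A : Fin m → Type*} (i : Fin m) (b : A i)
    (an : ∀ j : {j : Fin m // j ≠ i}, A j.1) : combine i b an i = b := by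
  simp [combine]

lemma restrict_combine {m : ℕ} {A : Fin m → Type*} (i : Fin m) (b : A i)
    (an : ∀ j : {j : Fin m // j ≠ i}, A j.1) : restrict i (combine i b an) = an := by
  funext j
  simp [_root_.restrict, combine, j.2]

lemma combine_restrict {m : ℕ} {A : Fin m → Type*} (i : Fin m) (q : ∀ j, A j) :
    combine i (q i) (restrict i q) = q := by
  funext j
  by_cases h : j = i
  · subst h
    simp [combine]
  · simp [combine, _root_.restrict, h]

/-- Summing over joint actions with prescribed `i`-th component amounts to summing over the
actions of the other players. -/
lemma sum_ite_apply_eq_combine {m : ℕ} {A : Fin m → Type*} [∀ j, Fintype (A j)]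
    [∀ j, DecidableEq (A j)] (i : Fin m) (b : A i)
    (w : (∀ j : {j : Fin m // j ≠ i}, A j.1) → ℝ) (G : (∀ j, A j) → ℝ) :
    ∑ q : ∀ j, A j, (if q i = b then (1 : ℝ) else 0) * w (restrict i q) * G q =
      ∑ an, w an * G (combine i b an) := by
  simp only [ite_mul, one_mul, zero_mul]
  rw [← Finset.sum_filter]
  refine Finset.sum_bij' (fun q _ => restrict i q) (fun an _ => combine i b an)
    (by simp) (by simp [combine_self]) ?_ (by simp [restrict_combine]) ?_
  · intro q hq
    rw [← (Finset.mem_filter.mp hq).2, combine_restrict]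
  · intro q hq
    rw [← (Finset.mem_filter.mp hq).2, combine_restrict]

/-- The Bellman operator is the mean of the regression target under the joint law of the other
players' actions and the next state, so Hoeffding's lemma bounds its exponential moments. -/
lemma sum_mul_exp_bell_le {S : Type*} [Fintype S] {m : ℕ} {A : Fin m → Type*}
    [∀ j, Fintype (A j)] [∀ j, DecidableEq (A j)] (i : Fin m)
    {P : ℕ → S → (∀ j, A j) → S → ℝ} {rew : ℕ → S → (∀ j, A j) → ℝ}
    {πneg : ℕ → S → (∀ j : {j : Fin m // j ≠ i}, A j.1) → ℝ} {h : ℕ} {c : ℝ}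
    (hP : ∀ s a, IsDist (P h s a)) (hπneg : ∀ s, IsDist (πneg h s))
    (polNext : S → A i) (f : S → A i → ℝ)
    (hY : ∀ s a s', rew h s a + f s' (polNext s') ∈ Set.Icc 0 c) (s : S) (b : A i) (u : ℝ) :
    ∑ an, πneg h s an * ∑ s', P h s (combine i b an) s' *
      Real.exp (u * (rew h s (combine i b an) + f s' (polNext s') -
        bell i P rew πneg polNext h f s b)) ≤ Real.exp (u ^ 2 * c ^ 2 / 8) := by
  let p : (∀ j : {j : Fin m // j ≠ i}, A j.1) × S → ℝ :=
    fun x => πneg h s x.1 * P h s (combine i b x.1) x.2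
  let Y : (∀ j : {j : Fin m // j ≠ i}, A j.1) × S → ℝ :=
    fun x => rew h s (combine i b x.1) + f x.2 (polNext x.2)
  have hp : IsDist p := by
    refine ⟨fun x => mul_nonneg ((hπneg s).1 _) ((hP _ _).1 _), ?_⟩
    simp only [p, Fintype.sum_prod_type, ← Finset.mul_sum, (hP _ _).2, mul_one, (hπneg s).2]
  have hmean : ∑ x, p x * Y x = bell i P rew πneg polNext h f s b := by
    simp only [p, Y, Fintype.sum_prod_type, bell, mul_assoc, ← Finset.mul_sum, mul_add,
      Finset.sum_add_distrib, ← Finset.sum_mul, (hP _ _).2, one_mul]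
  have hle := hp.sum_mul_exp_le (Y := Y) (fun x => hY _ _ _) u
  rw [hmean] at hle
  simpa only [p, Y, Fintype.sum_prod_type, mul_assoc, ← Finset.mul_sum] using hle

/-- uniform fast-rate square-loss concentration over function and
policy classes on adaptively collected episodes.  Fix player `i` and a Markov joint
policy `πneg` of the other players.  `Pc` is a finite class of deterministic Markov
policies of player `i` (via `pol`), and `Fc` a finite class of step-indexed functions
`S × A_i → [0, H]` (via `fc`, with the convention `fc g h = 0` for `h ≥ H`).  `K`
episodes are collected adaptively: at episode `t`, a policy `πsel t` (measurable in the
past) is played against `πneg`, producing states `st t h`, joint actions `aJ t h`, and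
(deterministic) rewards `rew h (st t h) (aJ t h)`; the generative model is encoded by
the conditional laws `haJlaw`, `hslaw` with respect to the within-episode filtration
`𝒢`.  Then with probability at least `1 - δ`, simultaneously for all `g ∈ Fc`,
`p ∈ Pc`, `k ∈ [K]`, `h ∈ [H]`:
`∑_{t=1}^k X_h^t(g, p) ≤ (1/2) ∑_{t=1}^k [(f_h - T f_{h+1})(s_h^t, a_{i,h}^t)]² +
 8 H² log(|Fc| |Pc| K H / δ)`. -/
theorem statement_14 {S : Type*} [Fintype S] {m Hh K : ℕ} {A : Fin m → Type*}
    [∀ j, Fintype (A j)] [∀ j, DecidableEq (A j)] (i : Fin m)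
    (P : ℕ → S → (∀ j, A j) → S → ℝ)
    (hP : ∀ h < Hh, ∀ s a, IsDist (P h s a))
    (rew : ℕ → S → (∀ j, A j) → ℝ)
    (hrew : ∀ h < Hh, ∀ s a, rew h s a ∈ Set.Icc (0 : ℝ) 1)
    (πneg : ℕ → S → (∀ j : {j : Fin m // j ≠ i}, A j.1) → ℝ)
    (hπneg : ∀ h < Hh, ∀ s, IsDist (πneg h s))
    (Pc Fc : Type*) [Fintype Pc] [Fintype Fc]
    (pol : Pc → ℕ → S → A i)
    (fc : Fc → ℕ → S → A i → ℝ)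
    (hfc : ∀ g, ∀ h < Hh, ∀ s b, fc g h s b ∈ Set.Icc (0 : ℝ) Hh)
    (hfcH : ∀ g h, Hh ≤ h → ∀ s b, fc g h s b = 0)
    (δ : ℝ) (hδ0 : 0 < δ) (hδ1 : δ < 1)
    (Ω : Type*) (m0 : MeasurableSpace Ω) (μ : Measure Ω) (hμ : IsProbabilityMeasure μ)
    -- `𝒢 t h` = information available in episode `t` just before the joint action at
    -- step `h` is drawn (it contains the first `t - 1` episodes, the selected policy
    -- `πsel t`, and the states/actions of episode `t` up to the state `st t h`)
    (𝒢 : ℕ → ℕ → MeasurableSpace Ω)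
    (h𝒢le : ∀ t h, 𝒢 t h ≤ m0)
    (h𝒢mono : ∀ t h, 𝒢 t h ≤ 𝒢 t (h + 1))
    (h𝒢ep : ∀ t, 𝒢 t Hh ≤ 𝒢 (t + 1) 0)
    (πsel : ℕ → Ω → Pc)
    (hπsel : ∀ t q, MeasurableSet[𝒢 t 0] {ω | πsel t ω = q})
    (st : ℕ → ℕ → Ω → S) (s1 : S)
    (hs1 : ∀ t ω, st t 0 ω = s1)
    (hstmeas : ∀ t h, h ≤ Hh → ∀ s, MeasurableSet[𝒢 t h] {ω | st t h ω = s})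
    (aJ : ℕ → ℕ → Ω → ∀ j, A j)
    (haJmeas : ∀ t h, h < Hh → ∀ q, MeasurableSet[𝒢 t (h + 1)] {ω | aJ t h ω = q})
    -- player `i` plays `pol (πsel t) h (st t h)` deterministically, and the other
    -- players draw their actions from `πneg h (st t h)`
    (haJlaw : ∀ t < K, ∀ h < Hh, ∀ q : ∀ j, A j,
      μ[Set.indicator {ω | aJ t h ω = q} (fun _ => (1 : ℝ)) | 𝒢 t h] =ᵐ[μ]
        fun ω => (if q i = pol (πsel t ω) h (st t h ω) then (1 : ℝ) else 0) *
          πneg h (st t h ω) (restrict i q))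
    -- the next state is drawn from `P h (st t h) (aJ t h)`
    (hslaw : ∀ t < K, ∀ h < Hh, ∀ s' : S,
      μ[Set.indicator {ω | st t (h + 1) ω = s'} (fun _ => (1 : ℝ)) |
          (𝒢 t h) ⊔ MeasurableSpace.comap (aJ t h) ⊤] =ᵐ[μ]
        fun ω => P h (st t h ω) (aJ t h ω) s') :
    ENNReal.ofReal (1 - δ) ≤
      μ {ω | ∀ (g : Fc) (p : Pc), ∀ k ≤ K, ∀ h < Hh,
        ∑ t ∈ Finset.range k,
            2 * (fc g h (st t h ω) (aJ t h ω i) -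
                bell i P rew πneg (pol p (h + 1)) h (fc g (h + 1))
                  (st t h ω) (aJ t h ω i)) *
              (rew h (st t h ω) (aJ t h ω) +
                fc g (h + 1) (st t (h + 1) ω) (pol p (h + 1) (st t (h + 1) ω)) -
                bell i P rew πneg (pol p (h + 1)) h (fc g (h + 1))
                  (st t h ω) (aJ t h ω i))
          ≤ (1 / 2 : ℝ) * ∑ t ∈ Finset.range k,
                (fc g h (st t h ω) (aJ t h ω i) -
                  bell i P rew πneg (pol p (h + 1)) h (fc g (h + 1))
                    (st t h ω) (aJ t h ω i)) ^ 2
              + 8 * Hh ^ 2 *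
                Real.log ((Fintype.card Fc : ℝ) * Fintype.card Pc * K * Hh / δ)} := by
  classical
  have hmono (t : ℕ) {h h' : ℕ} (hh : h ≤ h') : 𝒢 t h ≤ 𝒢 t h' :=
    monotone_nat_of_le_succ (h𝒢mono t) hh
  let D : Fc → Pc → ℕ → S → (∀ j, A j) → ℝ := fun g p h s q =>
    fc g h s (q i) - bell i P rew πneg (pol p (h + 1)) h (fc g (h + 1)) s (q i)
  let ξ : Fc → Pc → ℕ → S → (∀ j, A j) → S → ℝ := fun g p h s q s' =>
    rew h s q + fc g (h + 1) s' (pol p (h + 1) s') -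
      bell i P rew πneg (pol p (h + 1)) h (fc g (h + 1)) s (q i)
  let N : ℝ := (Fintype.card Fc : ℝ) * Fintype.card Pc * K * Hh
  let bad : Fc → Pc → ℕ → ℕ → Set Ω := fun g p k h =>
    {ω | N / δ ≤ ∏ t ∈ Finset.range k, Real.exp (((Hh : ℝ) + 1)⁻¹ ^ 2 *
      (2 * D g p h (st t h ω) (aJ t h ω) *
        ξ g p h (st t h ω) (aJ t h ω) (st t (h + 1) ω) -
        D g p h (st t h ω) (aJ t h ω) ^ 2 / 2))}
  have hbad (g : Fc) (p : Pc) {k h : ℕ} (hk1 : 1 ≤ k) (hk : k ≤ K) (hh : h < Hh) :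
      μ (bad g p k h) ≤ ENNReal.ofReal (δ / N) := by
    have hNpos : 0 < N := by
      have : Nonempty Fc := ⟨g⟩
      have : Nonempty Pc := ⟨p⟩
      have h1 : (0 : ℝ) < Fintype.card Fc := by exact_mod_cast Fintype.card_pos
      have h2 : (0 : ℝ) < Fintype.card Pc := by exact_mod_cast Fintype.card_pos
      have h3 : (0 : ℝ) < K := by exact_mod_cast hk1.trans hk
      have h4 : (0 : ℝ) < Hh := by exact_mod_cast (Nat.zero_le h).trans_lt hh
      positivity
    have hY (s : S) (a : ∀ j, A j) (s' : S) :
        rew h s a + fc g (h + 1) s' (pol p (h + 1) s') ∈ Set.Icc (0 : ℝ) (Hh + 1) := by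
      have h1 := hrew h hh s a
      have h2 : fc g (h + 1) s' (pol p (h + 1) s') ∈ Set.Icc (0 : ℝ) Hh := by
        rcases lt_or_ge (h + 1) Hh with h3 | h3
        · exact hfc g _ h3 _ _
        · rw [hfcH g _ h3]
          exact ⟨le_rfl, Nat.cast_nonneg _⟩
      exact ⟨add_nonneg h1.1 h2.1, by linarith [h1.2, h2.2]⟩
    have hstep (t : ℕ) : 𝒢 t (h + 1) ≤ 𝒢 (t + 1) h :=
      (hmono t hh).trans ((h𝒢ep t).trans (hmono (t + 1) (Nat.zero_le h)))
    have hprod := integral_prod_increments_le_one (K := K) (μ := μ)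
      (ℱ := fun t => 𝒢 t h) (fun t => h𝒢le t h)
      (fun t => (h𝒢mono t h).trans (hstep t))
      (X := fun t => st t h) (X' := fun t => st t (h + 1)) (a := fun t => aJ t h)
      (fun t => hstmeas t h hh.le) (fun t s => hstep t _ (hstmeas t (h + 1) hh s))
      (fun t q => hstep t _ (haJmeas t h hh q))
      (c := fun t ω q => (if q i = pol (πsel t ω) h (st t h ω) then (1 : ℝ) else 0) *
        πneg h (st t h ω) (_root_.restrict i q))
      (fun t ω q => mul_nonneg (by split_ifs <;> norm_num) ((hπneg h hh _).1 _))
      (fun t ht => haJlaw t ht h hh) (P := P h) (fun s q => (hP h hh s q).1)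
      (fun t ht => hslaw t ht h hh)
      (φ := fun s q s' => Real.exp (((Hh : ℝ) + 1)⁻¹ ^ 2 *
        (2 * D g p h s q * ξ g p h s q s' - D g p h s q ^ 2 / 2)))
      (fun _ _ _ => (Real.exp_pos _).le)
      (fun t ω => by
        rw [sum_ite_apply_eq_combine]
        simp only [D, ξ, combine_self]
        set s := st t h ω
        set b := pol (πsel t ω) h s
        set d := fc g h s b - bell i P rew πneg (pol p (h + 1)) h (fc g (h + 1)) s b
        have hle := sum_mul_exp_bell_le i (hP h hh) (hπneg h hh) (pol p (h + 1))
          (fc g (h + 1)) hY s b (2 * (((Hh : ℝ) + 1)⁻¹ ^ 2) * d)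
        have hexp : (2 * (((Hh : ℝ) + 1)⁻¹ ^ 2) * d) ^ 2 * ((Hh : ℝ) + 1) ^ 2 / 8 =
            ((Hh : ℝ) + 1)⁻¹ ^ 2 * (d ^ 2 / 2) := by
          have : (Hh : ℝ) + 1 ≠ 0 := by positivity
          field_simp
          ring
        rw [hexp] at hle
        have hmul := mul_le_mul_of_nonneg_right hle
          (Real.exp_pos (-(((Hh : ℝ) + 1)⁻¹ ^ 2 * (d ^ 2 / 2)))).le
        rw [← Real.exp_add, add_neg_cancel, Real.exp_zero] at hmul
        refine le_trans (le_of_eq ?_) hmul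
        rw [Finset.sum_mul]
        refine Finset.sum_congr rfl fun an _ => ?_
        rw [mul_assoc, Finset.sum_mul]
        congr 1
        refine Finset.sum_congr rfl fun s' _ => ?_
        rw [mul_assoc (P h s (combine i b an) s'), ← Real.exp_add]
        congr 2
        ring)
      hk
    have hmarkov := mul_meas_ge_le_integral_of_nonneg (μ := μ)
      (Filter.Eventually.of_forall fun ω =>
        Finset.prod_nonneg fun t _ => (Real.exp_pos _).le) hprod.1 (N / δ)
    have hreal : μ.real (bad g p k h) ≤ δ / N := by
      have h1 : N / δ * μ.real (bad g p k h) ≤ 1 := hmarkov.trans hprod.2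
      rw [le_div_iff₀ hNpos]
      rw [div_mul_eq_mul_div, div_le_one hδ0] at h1
      linarith
    rw [← ENNReal.ofReal_toReal (measure_ne_top μ (bad g p k h))]
    exact ENNReal.ofReal_le_ofReal hreal
  have hNnat : N = ((Fintype.card Fc * Fintype.card Pc * K * Hh : ℕ) : ℝ) := by
    simp only [N, Nat.cast_mul]
  have hlog : 0 ≤ Real.log (N / δ) := by
    rcases Nat.eq_zero_or_pos (Fintype.card Fc * Fintype.card Pc * K * Hh) with h0 | hpos
    · rw [hNnat, h0]
      simp
    · have h1 : (1 : ℝ) ≤ N := by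
        rw [hNnat]
        exact_mod_cast hpos
      refine Real.log_nonneg ?_
      rw [le_div_iff₀ hδ0]
      linarith
  set good := {ω | ∀ (g : Fc) (p : Pc), ∀ k ≤ K, ∀ h < Hh, _} with hgood
  let idx := ((Finset.univ : Finset Fc) ×ˢ (Finset.univ : Finset Pc)) ×ˢ
    (Finset.Icc 1 K ×ˢ Finset.range Hh)
  have hcover : goodᶜ ⊆ ⋃ x ∈ idx, bad x.1.1 x.1.2 x.2.1 x.2.2 := by
    intro ω hω
    rw [hgood] at hω
    simp only [Set.mem_compl_iff, Set.mem_ofPred_eq, not_forall] at hω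
    obtain ⟨g, p, k, hk, h, hh, hlt⟩ := hω
    rw [not_le] at hlt
    have hk1 : 1 ≤ k := by
      rcases Nat.eq_zero_or_pos k with rfl | hpos
      · simp only [Finset.range_zero, Finset.sum_empty, mul_zero, zero_add] at hlt
        exact absurd hlt (not_lt.mpr (mul_nonneg (by positivity) hlog))
      · exact hpos
    refine Set.mem_biUnion (x := ((g, p), (k, h))) (by simp [idx, hk1, hk, hh]) ?_
    have hH : (1 : ℝ) ≤ Hh := by exact_mod_cast (Nat.zero_le h).trans_lt hh
    have hcoef : 1 ≤ ((Hh : ℝ) + 1)⁻¹ ^ 2 * (8 * Hh ^ 2) := by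
      rw [inv_pow, inv_mul_eq_div, one_le_div (by positivity)]
      nlinarith
    have hpos : 0 < N / δ := by
      have h1 : N ≠ 0 := by
        have : Nonempty Fc := ⟨g⟩
        have : Nonempty Pc := ⟨p⟩
        have h3 : K ≠ 0 := by omega
        have h4 : Hh ≠ 0 := by omega
        simp [N, h3, h4]
      have h2 : 0 ≤ N := by
        rw [hNnat]
        exact Nat.cast_nonneg _
      exact div_pos (h2.lt_of_ne' h1) hδ0
    change N / δ ≤ _
    rw [← Real.exp_sum, ← Finset.mul_sum, Finset.sum_sub_distrib, ← Finset.sum_div,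
      ← Real.log_le_iff_le_exp hpos]
    calc Real.log (N / δ)
        ≤ ((Hh : ℝ) + 1)⁻¹ ^ 2 * (8 * Hh ^ 2) * Real.log (N / δ) :=
          le_mul_of_one_le_left hlog hcoef
      _ = ((Hh : ℝ) + 1)⁻¹ ^ 2 * (8 * Hh ^ 2 * Real.log (N / δ)) := by ring
      _ ≤ _ := mul_le_mul_of_nonneg_left
          (by simp only [D, ξ, N]; linarith) (by positivity)
  have hcompl : μ goodᶜ ≤ ENNReal.ofReal δ := by
    have hcard : (idx.card : ℝ) = N := by
      simp only [idx, Finset.card_product, Finset.card_univ, Nat.card_Icc, Finset.card_range,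
        Nat.add_sub_cancel, Nat.cast_mul, N]
      ring
    calc μ goodᶜ ≤ μ (⋃ x ∈ idx, bad x.1.1 x.1.2 x.2.1 x.2.2) := measure_mono hcover
      _ ≤ ∑ x ∈ idx, μ (bad x.1.1 x.1.2 x.2.1 x.2.2) := measure_biUnion_finset_le _ _
      _ ≤ idx.card • ENNReal.ofReal (δ / N) := by
          refine Finset.sum_le_card_nsmul _ _ _ fun x hx => ?_
          simp only [idx, Finset.mem_product, Finset.mem_Icc, Finset.mem_range] at hx
          exact hbad _ _ hx.2.1.1 hx.2.1.2 hx.2.2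
      _ = ENNReal.ofReal (N * (δ / N)) := by
          rw [← ENNReal.ofReal_nsmul, nsmul_eq_mul, hcard]
      _ ≤ ENNReal.ofReal δ := by
          refine ENNReal.ofReal_le_ofReal ?_
          rcases eq_or_ne N 0 with h0 | h0
          · simp [h0, hδ0.le]
          · rw [mul_div_cancel₀ _ h0]
  have huniv : 1 ≤ μ good + μ goodᶜ := by
    rw [← measure_univ (μ := μ), ← Set.union_compl_self good]
    exact measure_union_le _ _
  rw [ENNReal.ofReal_sub _ hδ0.le, ENNReal.ofReal_one, tsub_le_iff_right]
  exact huniv.trans (by gcongr)
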